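/- (Lolli admits coincided provability.) A Lolli sequent Γ;Δ ⊢ G has a simple proof if and only if it has a coincided proof. Here a simple proof is a uniform proof (one in which every sequent with a non-atomic goal is the conclusion of the right rule introducing the goal's top-level symbol) in which every left-introduction rule instance acts on a marked principal formula, where a bounded-context formula is marked if it is the principal formula of an id instance, or it is B₁&B₂ in the conclusion of a &L instance whose premise has Bᵢ marked, or ∀x.B in the conclusion of a ∀L instance whose premise has B[t/x] marked, or G⊸P (respectively G⇒P) in the conclusion of a ⊸L (respectively ⇒L) instance whose right-hand premise has P marked. A coincided proof is a simple proof in which, for every absorb rule instance, the copy of its principal formula introduced into the bounded context of the premise is the principal formula of a left-introduction or id rule instance directly above it. -/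

import Mathlib

/- The language of Lolli.  `α` is the type of atomic formulas and `T` is the
type of first-order terms; quantification is represented in higher-order
abstract syntax over `T`, so that the substitution `B[t/x]` appearing in the
∀L and ∃R rules is function application, and the eigenvariable condition of
∀R is expressed by quantifying over all terms. -/
mutual

/-- Program clause formulas: `P ::= A | P & P | G ⊸ P | G ⇒ P | ∀x.P`. -/
inductive PF (α T : Type) : Type
  | atom : α → PF α T
  | conj : PF α T → PF α T → PF α T
  | limp : GF α T → PF α T → PF α T     -- `G ⊸ P`
  | imp  : GF α T → PF α T → PF α T     -- `G ⇒ P`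
  | all  : (T → PF α T) → PF α T

/-- Goal formulas:
`G ::= ⊤ | A | G & G | P ⊸ G | P ⇒ G | ∀x.G | ∃x.G | !G | G ⊗ G | G ⊕ G`. -/
inductive GF (α T : Type) : Type
  | top  : GF α T
  | atom : α → GF α T
  | conj : GF α T → GF α T → GF α T
  | limp : PF α T → GF α T → GF α T     -- `P ⊸ G`
  | imp  : PF α T → GF α T → GF α T     -- `P ⇒ G`
  | all  : (T → GF α T) → GF α T
  | ex   : (T → GF α T) → GF α T
  | bang : GF α T → GF α T
  | tensor : GF α T → GF α T → GF α T
  | oplus  : GF α T → GF α T → GF α T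

end

/-- Proof trees for Lolli sequents, represented as data so that properties of
the *shape* of a proof (uniformity, markedness, etc.) can be expressed.  Each
constructor is one inference rule of Lolli; principal formulas are explicit
arguments. -/
inductive Proof {α T : Type} : Set (PF α T) → Multiset (PF α T) → GF α T → Type
  | id (Γ : Set (PF α T)) (a : α) : Proof Γ {PF.atom a} (GF.atom a)
  | absorb {Γ Δ G} (B : PF α T) : B ∈ Γ → Proof Γ (B ::ₘ Δ) G → Proof Γ Δ G
  | topR (Γ : Set (PF α T)) (Δ : Multiset (PF α T)) : Proof Γ Δ GF.top
  | conjL₁ {Γ Δ G} (B₁ B₂ : PF α T) :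
      Proof Γ (B₁ ::ₘ Δ) G → Proof Γ (PF.conj B₁ B₂ ::ₘ Δ) G
  | conjL₂ {Γ Δ G} (B₁ B₂ : PF α T) :
      Proof Γ (B₂ ::ₘ Δ) G → Proof Γ (PF.conj B₁ B₂ ::ₘ Δ) G
  | conjR {Γ Δ} {G₁ G₂ : GF α T} :
      Proof Γ Δ G₁ → Proof Γ Δ G₂ → Proof Γ Δ (GF.conj G₁ G₂)
  | limpL {Γ Δ₁ Δ₂ G} (G₁ : GF α T) (B₂ : PF α T) :
      Proof Γ Δ₁ G₁ → Proof Γ (B₂ ::ₘ Δ₂) G →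
      Proof Γ (PF.limp G₁ B₂ ::ₘ (Δ₁ + Δ₂)) G
  | limpR {Γ Δ} {B : PF α T} {G : GF α T} :
      Proof Γ (B ::ₘ Δ) G → Proof Γ Δ (GF.limp B G)
  | impL {Γ Δ G} (G₁ : GF α T) (B₂ : PF α T) :
      Proof Γ 0 G₁ → Proof Γ (B₂ ::ₘ Δ) G → Proof Γ (PF.imp G₁ B₂ ::ₘ Δ) G
  | impR {Γ Δ} {B : PF α T} {G : GF α T} :
      Proof (insert B Γ) Δ G → Proof Γ Δ (GF.imp B G)
  | allL {Γ Δ G} (B : T → PF α T) (t : T) :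
      Proof Γ (B t ::ₘ Δ) G → Proof Γ (PF.all B ::ₘ Δ) G
  | allR {Γ Δ} {G : T → GF α T} :
      (∀ t : T, Proof Γ Δ (G t)) → Proof Γ Δ (GF.all G)
  | exR {Γ Δ} {G : T → GF α T} (t : T) : Proof Γ Δ (G t) → Proof Γ Δ (GF.ex G)
  | bangR {Γ} {G : GF α T} : Proof Γ 0 G → Proof Γ 0 (GF.bang G)
  | oplusR₁ {Γ Δ} {G₁ G₂ : GF α T} : Proof Γ Δ G₁ → Proof Γ Δ (GF.oplus G₁ G₂)
  | oplusR₂ {Γ Δ} {G₁ G₂ : GF α T} : Proof Γ Δ G₂ → Proof Γ Δ (GF.oplus G₁ G₂)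
  | tensorR {Γ Δ₁ Δ₂} {G₁ G₂ : GF α T} :
      Proof Γ Δ₁ G₁ → Proof Γ Δ₂ G₂ → Proof Γ (Δ₁ + Δ₂) (GF.tensor G₁ G₂)

/-- A goal formula is atomic if it is of the form `A`. -/
def AtomicGoal {α T : Type} : GF α T → Prop
  | GF.atom _ => True
  | _ => False

/-- A proof is uniform if every sequent occurring in it whose goal formula is
non-atomic is the conclusion of the right-introduction rule for the top-level
logical symbol of that goal formula.  Equivalently (since each sequent in a
proof tree is the conclusion of exactly one rule instance, and each
right-introduction rule introduces the top-level symbol of its conclusion's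
goal): the conclusion of every `id`, `absorb` and left-introduction rule
instance has an atomic goal, recursively throughout the proof. -/
def Uniform {α T : Type} : ∀ {Γ : Set (PF α T)} {Δ : Multiset (PF α T)}
    {G : GF α T}, Proof Γ Δ G → Prop
  | _, _, _, Proof.id _ _ => True
  | _, _, G, Proof.absorb _ _ p => AtomicGoal G ∧ Uniform p
  | _, _, _, Proof.topR _ _ => True
  | _, _, G, Proof.conjL₁ _ _ p => AtomicGoal G ∧ Uniform p
  | _, _, G, Proof.conjL₂ _ _ p => AtomicGoal G ∧ Uniform p
  | _, _, _, Proof.conjR p q => Uniform p ∧ Uniform q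
  | _, _, G, Proof.limpL _ _ p q => AtomicGoal G ∧ Uniform p ∧ Uniform q
  | _, _, _, Proof.limpR p => Uniform p
  | _, _, G, Proof.impL _ _ p q => AtomicGoal G ∧ Uniform p ∧ Uniform q
  | _, _, _, Proof.impR p => Uniform p
  | _, _, G, Proof.allL _ _ p => AtomicGoal G ∧ Uniform p
  | _, _, _, Proof.allR p => ∀ t, Uniform (p t)
  | _, _, _, Proof.exR _ p => Uniform p
  | _, _, _, Proof.bangR p => Uniform p
  | _, _, _, Proof.oplusR₁ p => Uniform p
  | _, _, _, Proof.oplusR₂ p => Uniform p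
  | _, _, _, Proof.tensorR p q => Uniform p ∧ Uniform q

/-- `MarkedRoot p F` says that the formula `F` is marked in the bounded
context of the conclusion sequent of the proof `p`, following the inductive
definition of marking: a formula is marked if it is the principal formula of
an `id` instance, or it is `B₁ & B₂` in the conclusion of a `&L` instance
whose premise has `Bᵢ` marked, or `∀x.B` in the conclusion of a `∀L` instance
whose premise has `B[t/x]` marked, or `G ⊸ P` (resp. `G ⇒ P`) in the
conclusion of a `⊸L` (resp. `⇒L`) instance whose right-hand premise has `P`
marked. -/
def MarkedRoot {α T : Type} : ∀ {Γ : Set (PF α T)} {Δ : Multiset (PF α T)}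
    {G : GF α T}, Proof Γ Δ G → PF α T → Prop
  | _, _, _, Proof.id _ a, F => F = PF.atom a
  | _, _, _, Proof.conjL₁ B₁ B₂ p, F => F = PF.conj B₁ B₂ ∧ MarkedRoot p B₁
  | _, _, _, Proof.conjL₂ B₁ B₂ p, F => F = PF.conj B₁ B₂ ∧ MarkedRoot p B₂
  | _, _, _, Proof.allL B t p, F => F = PF.all B ∧ MarkedRoot p (B t)
  | _, _, _, Proof.limpL G₁ B₂ _ q, F => F = PF.limp G₁ B₂ ∧ MarkedRoot q B₂
  | _, _, _, Proof.impL G₁ B₂ _ q, F => F = PF.imp G₁ B₂ ∧ MarkedRoot q B₂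
  | _, _, _, _, _ => False

/-- `Simple p` says that every left-introduction rule instance in `p` acts on
a marked principal formula (a simple proof is a *uniform* proof with this
property; uniformity is stated separately). -/
def Simple {α T : Type} : ∀ {Γ : Set (PF α T)} {Δ : Multiset (PF α T)}
    {G : GF α T}, Proof Γ Δ G → Prop
  | _, _, _, Proof.id _ _ => True
  | _, _, _, Proof.absorb _ _ p => Simple p
  | _, _, _, Proof.topR _ _ => True
  | _, _, _, Proof.conjL₁ B₁ B₂ p =>
      MarkedRoot (Proof.conjL₁ B₁ B₂ p) (PF.conj B₁ B₂) ∧ Simple p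
  | _, _, _, Proof.conjL₂ B₁ B₂ p =>
      MarkedRoot (Proof.conjL₂ B₁ B₂ p) (PF.conj B₁ B₂) ∧ Simple p
  | _, _, _, Proof.conjR p q => Simple p ∧ Simple q
  | _, _, _, Proof.limpL G₁ B₂ p q =>
      MarkedRoot (Proof.limpL G₁ B₂ p q) (PF.limp G₁ B₂) ∧ Simple p ∧ Simple q
  | _, _, _, Proof.limpR p => Simple p
  | _, _, _, Proof.impL G₁ B₂ p q =>
      MarkedRoot (Proof.impL G₁ B₂ p q) (PF.imp G₁ B₂) ∧ Simple p ∧ Simple q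
  | _, _, _, Proof.impR p => Simple p
  | _, _, _, Proof.allL B t p =>
      MarkedRoot (Proof.allL B t p) (PF.all B) ∧ Simple p
  | _, _, _, Proof.allR p => ∀ t, Simple (p t)
  | _, _, _, Proof.exR _ p => Simple p
  | _, _, _, Proof.bangR p => Simple p
  | _, _, _, Proof.oplusR₁ p => Simple p
  | _, _, _, Proof.oplusR₂ p => Simple p
  | _, _, _, Proof.tensorR p q => Simple p ∧ Simple q

/-- `PrincipalRoot p F` says that the rule instance at the root of `p` is a
left-introduction or `id` rule instance whose principal formula is `F`. -/
def PrincipalRoot {α T : Type} : ∀ {Γ : Set (PF α T)} {Δ : Multiset (PF α T)}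
    {G : GF α T}, Proof Γ Δ G → PF α T → Prop
  | _, _, _, Proof.id _ a, F => F = PF.atom a
  | _, _, _, Proof.conjL₁ B₁ B₂ _, F => F = PF.conj B₁ B₂
  | _, _, _, Proof.conjL₂ B₁ B₂ _, F => F = PF.conj B₁ B₂
  | _, _, _, Proof.allL B _ _, F => F = PF.all B
  | _, _, _, Proof.limpL G₁ B₂ _ _, F => F = PF.limp G₁ B₂
  | _, _, _, Proof.impL G₁ B₂ _ _, F => F = PF.imp G₁ B₂
  | _, _, _, _, _ => False

/-- `Coincided p` says that for every `absorb` rule instance in `p`, the copy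
of its principal formula introduced into the bounded context of its premise is
the principal formula of a left-introduction or `id` rule instance directly
above it (a coincided proof is a *simple* proof with this property; simplicity
and uniformity are stated separately). -/
def Coincided {α T : Type} : ∀ {Γ : Set (PF α T)} {Δ : Multiset (PF α T)}
    {G : GF α T}, Proof Γ Δ G → Prop
  | _, _, _, Proof.id _ _ => True
  | _, _, _, Proof.absorb B _ p => PrincipalRoot p B ∧ Coincided p
  | _, _, _, Proof.topR _ _ => True
  | _, _, _, Proof.conjL₁ _ _ p => Coincided p
  | _, _, _, Proof.conjL₂ _ _ p => Coincided p
  | _, _, _, Proof.conjR p q => Coincided p ∧ Coincided q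
  | _, _, _, Proof.limpL _ _ p q => Coincided p ∧ Coincided q
  | _, _, _, Proof.limpR p => Coincided p
  | _, _, _, Proof.impL _ _ p q => Coincided p ∧ Coincided q
  | _, _, _, Proof.impR p => Coincided p
  | _, _, _, Proof.allL _ _ p => Coincided p
  | _, _, _, Proof.allR p => ∀ t, Coincided (p t)
  | _, _, _, Proof.exR _ p => Coincided p
  | _, _, _, Proof.bangR p => Coincided p
  | _, _, _, Proof.oplusR₁ p => Coincided p
  | _, _, _, Proof.oplusR₂ p => Coincided p
  | _, _, _, Proof.tensorR p q => Coincided p ∧ Coincided q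

/-- Focused derivations.  `Focused Γ Δ none G` is the search for a goal-directed proof of `Γ ; Δ ⊢ G`;
`Focused Γ Δ (some F) G` decomposes the distinguished formula `F` of `Γ ; F, Δ ⊢ G` down to an
initial sequent.  A clause of `Γ` is only copied when it is about to be decomposed. -/
inductive Focused {α T : Type} :
    Set (PF α T) → Multiset (PF α T) → Option (PF α T) → GF α T → Prop
  | id (Γ : Set (PF α T)) (a : α) : Focused Γ 0 (some (PF.atom a)) (GF.atom a)
  | conjL₁ {Γ Δ a} (B₁ B₂ : PF α T) :
      Focused Γ Δ (some B₁) (GF.atom a) → Focused Γ Δ (some (PF.conj B₁ B₂)) (GF.atom a)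
  | conjL₂ {Γ Δ a} (B₁ B₂ : PF α T) :
      Focused Γ Δ (some B₂) (GF.atom a) → Focused Γ Δ (some (PF.conj B₁ B₂)) (GF.atom a)
  | limpL {Γ Δ₁ Δ₂ a} (G : GF α T) (B : PF α T) :
      Focused Γ Δ₁ none G → Focused Γ Δ₂ (some B) (GF.atom a) →
      Focused Γ (Δ₁ + Δ₂) (some (PF.limp G B)) (GF.atom a)
  | impL {Γ Δ a} (G : GF α T) (B : PF α T) :
      Focused Γ 0 none G → Focused Γ Δ (some B) (GF.atom a) →
      Focused Γ Δ (some (PF.imp G B)) (GF.atom a)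
  | allL {Γ Δ a} (B : T → PF α T) (t : T) :
      Focused Γ Δ (some (B t)) (GF.atom a) → Focused Γ Δ (some (PF.all B)) (GF.atom a)
  | focus {Γ Δ a} (F : PF α T) :
      Focused Γ Δ (some F) (GF.atom a) → Focused Γ (F ::ₘ Δ) none (GF.atom a)
  | absorb {Γ Δ a} (F : PF α T) : F ∈ Γ →
      Focused Γ Δ (some F) (GF.atom a) → Focused Γ Δ none (GF.atom a)
  | topR (Γ : Set (PF α T)) (Δ : Multiset (PF α T)) : Focused Γ Δ none GF.top
  | conjR {Γ Δ} {G₁ G₂ : GF α T} :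
      Focused Γ Δ none G₁ → Focused Γ Δ none G₂ → Focused Γ Δ none (GF.conj G₁ G₂)
  | limpR {Γ Δ} {B : PF α T} {G : GF α T} :
      Focused Γ (B ::ₘ Δ) none G → Focused Γ Δ none (GF.limp B G)
  | impR {Γ Δ} {B : PF α T} {G : GF α T} :
      Focused (insert B Γ) Δ none G → Focused Γ Δ none (GF.imp B G)
  | allR {Γ Δ} {G : T → GF α T} :
      (∀ t : T, Focused Γ Δ none (G t)) → Focused Γ Δ none (GF.all G)
  | exR {Γ Δ} {G : T → GF α T} (t : T) :
      Focused Γ Δ none (G t) → Focused Γ Δ none (GF.ex G)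
  | bangR {Γ} {G : GF α T} : Focused Γ 0 none G → Focused Γ 0 none (GF.bang G)
  | oplusR₁ {Γ Δ} {G₁ G₂ : GF α T} :
      Focused Γ Δ none G₁ → Focused Γ Δ none (GF.oplus G₁ G₂)
  | oplusR₂ {Γ Δ} {G₁ G₂ : GF α T} :
      Focused Γ Δ none G₂ → Focused Γ Δ none (GF.oplus G₁ G₂)
  | tensorR {Γ Δ₁ Δ₂} {G₁ G₂ : GF α T} :
      Focused Γ Δ₁ none G₁ → Focused Γ Δ₂ none G₂ →
      Focused Γ (Δ₁ + Δ₂) none (GF.tensor G₁ G₂)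

theorem Multiset.eq_cons_add_or_eq_add_cons {β : Type*} {s t u : Multiset β} {b : β}
    (h : s + t = b ::ₘ u) :
    (∃ s', s = b ::ₘ s' ∧ u = s' + t) ∨ ∃ t', t = b ::ₘ t' ∧ u = s + t' := by
  have hb : b ∈ s + t := h ▸ Multiset.mem_cons_self b u
  rcases Multiset.mem_add.1 hb with hb | hb
  · obtain ⟨s', rfl⟩ := Multiset.exists_cons_of_mem hb
    exact .inl ⟨s', rfl, by simpa using h.symm⟩
  · obtain ⟨t', rfl⟩ := Multiset.exists_cons_of_mem hb
    exact .inr ⟨t', rfl, by simpa using h.symm⟩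

/-- The unrestricted absorb rule is admissible for focused derivations. -/
theorem Focused.absorb_admissible {α T : Type} {Γ : Set (PF α T)} {Δ : Multiset (PF α T)}
    {o : Option (PF α T)} {G : GF α T} (h : Focused Γ Δ o G) {B : PF α T}
    {Δ' : Multiset (PF α T)} (hB : B ∈ Γ) (hΔ : Δ = B ::ₘ Δ') : Focused Γ Δ' o G := by
  induction h generalizing Δ' with
  | id | bangR => exact absurd hΔ.symm (Multiset.cons_ne_zero)
  | conjL₁ B₁ B₂ _ ih => exact .conjL₁ B₁ B₂ (ih hB hΔ)
  | conjL₂ B₁ B₂ _ ih => exact .conjL₂ B₁ B₂ (ih hB hΔ)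
  | limpL G F h₁ h₂ ih₁ ih₂ =>
    obtain ⟨s, hs, rfl⟩ | ⟨s, hs, rfl⟩ := Multiset.eq_cons_add_or_eq_add_cons hΔ
    · exact .limpL G F (ih₁ hB hs) h₂
    · exact .limpL G F h₁ (ih₂ hB hs)
  | impL G F h₁ _ _ ih => exact .impL G F h₁ (ih hB hΔ)
  | allL F t _ ih => exact .allL F t (ih hB hΔ)
  | focus F h ih =>
    rcases Multiset.cons_eq_cons.1 hΔ with ⟨rfl, rfl⟩ | ⟨_, s, hs, rfl⟩
    · exact .absorb _ hB h
    · exact .focus F (ih hB hs)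
  | absorb F hF _ ih => exact .absorb F hF (ih hB hΔ)
  | topR => exact .topR _ _
  | conjR _ _ ih₁ ih₂ => exact .conjR (ih₁ hB hΔ) (ih₂ hB hΔ)
  | limpR _ ih => exact .limpR (ih hB (by rw [hΔ, Multiset.cons_swap]))
  | impR _ ih => exact .impR (ih (Set.mem_insert_of_mem _ hB) hΔ)
  | allR _ ih => exact .allR fun t => ih t hB hΔ
  | exR t _ ih => exact .exR t (ih hB hΔ)
  | oplusR₁ _ ih => exact .oplusR₁ (ih hB hΔ)
  | oplusR₂ _ ih => exact .oplusR₂ (ih hB hΔ)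
  | tensorR h₁ h₂ ih₁ ih₂ =>
    obtain ⟨s, hs, rfl⟩ | ⟨s, hs, rfl⟩ := Multiset.eq_cons_add_or_eq_add_cons hΔ
    · exact .tensorR (ih₁ hB hs) h₂
    · exact .tensorR h₁ (ih₂ hB hs)

theorem AtomicGoal.exists_eq_atom {α T : Type} {G : GF α T} (h : AtomicGoal G) :
    ∃ a, G = GF.atom a := by
  cases G <;> simp_all [AtomicGoal]

/-- A simple proof whose root marks `F` decomposes `F`. -/
theorem Proof.exists_focused {α T : Type} {Γ : Set (PF α T)} {Δ : Multiset (PF α T)}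
    {G : GF α T} (p : Proof Γ Δ G) (hU : Uniform p) (hS : Simple p) :
    Focused Γ Δ none G ∧
      ∀ F, MarkedRoot p F → ∃ Δ', Δ = F ::ₘ Δ' ∧ Focused Γ Δ' (some F) G := by
  have focus_of_decomposed {Γ : Set (PF α T)} {Δ : Multiset (PF α T)} {F : PF α T} {a : α}
      (h : Focused Γ Δ (some F) (GF.atom a)) :
      Focused Γ (F ::ₘ Δ) none (GF.atom a) ∧
        ∀ F', F' = F → ∃ Δ', F ::ₘ Δ = F' ::ₘ Δ' ∧ Focused Γ Δ' (some F') (GF.atom a) := by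
    refine ⟨.focus _ h, ?_⟩
    rintro _ rfl
    exact ⟨Δ, rfl, h⟩
  induction p with
  | id Γ a => exact focus_of_decomposed (.id Γ a)
  | absorb B hB p ih =>
    simp only [Uniform, Simple] at hU hS
    exact ⟨(ih hU.2 hS).1.absorb_admissible hB rfl, by simp [MarkedRoot]⟩
  | conjL₁ B₁ B₂ p ih =>
    simp only [Uniform, Simple, MarkedRoot, true_and] at hU hS
    obtain ⟨a, rfl⟩ := hU.1.exists_eq_atom
    obtain ⟨Δ', hΔ, h⟩ := (ih hU.2 hS.2).2 _ hS.1
    obtain rfl := (Multiset.cons_inj_right _).1 hΔ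
    simpa [MarkedRoot, hS.1] using focus_of_decomposed (.conjL₁ B₁ B₂ h)
  | conjL₂ B₁ B₂ p ih =>
    simp only [Uniform, Simple, MarkedRoot, true_and] at hU hS
    obtain ⟨a, rfl⟩ := hU.1.exists_eq_atom
    obtain ⟨Δ', hΔ, h⟩ := (ih hU.2 hS.2).2 _ hS.1
    obtain rfl := (Multiset.cons_inj_right _).1 hΔ
    simpa [MarkedRoot, hS.1] using focus_of_decomposed (.conjL₂ B₁ B₂ h)
  | limpL G F p q ih₁ ih₂ =>
    simp only [Uniform, Simple, MarkedRoot, true_and] at hU hS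
    obtain ⟨a, rfl⟩ := hU.1.exists_eq_atom
    obtain ⟨Δ', hΔ, h⟩ := (ih₂ hU.2.2 hS.2.2).2 _ hS.1
    obtain rfl := (Multiset.cons_inj_right _).1 hΔ
    simpa [MarkedRoot, hS.1] using focus_of_decomposed (.limpL G F (ih₁ hU.2.1 hS.2.1).1 h)
  | impL G F p q ih₁ ih₂ =>
    simp only [Uniform, Simple, MarkedRoot, true_and] at hU hS
    obtain ⟨a, rfl⟩ := hU.1.exists_eq_atom
    obtain ⟨Δ', hΔ, h⟩ := (ih₂ hU.2.2 hS.2.2).2 _ hS.1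
    obtain rfl := (Multiset.cons_inj_right _).1 hΔ
    simpa [MarkedRoot, hS.1] using focus_of_decomposed (.impL G F (ih₁ hU.2.1 hS.2.1).1 h)
  | allL F t p ih =>
    simp only [Uniform, Simple, MarkedRoot, true_and] at hU hS
    obtain ⟨a, rfl⟩ := hU.1.exists_eq_atom
    obtain ⟨Δ', hΔ, h⟩ := (ih hU.2 hS.2).2 _ hS.1
    obtain rfl := (Multiset.cons_inj_right _).1 hΔ
    simpa [MarkedRoot, hS.1] using focus_of_decomposed (.allL F t h)
  | topR => exact ⟨.topR _ _, by simp [MarkedRoot]⟩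
  | conjR p q ih₁ ih₂ => exact ⟨.conjR (ih₁ hU.1 hS.1).1 (ih₂ hU.2 hS.2).1, by simp [MarkedRoot]⟩
  | limpR p ih => exact ⟨.limpR (ih hU hS).1, by simp [MarkedRoot]⟩
  | impR p ih => exact ⟨.impR (ih hU hS).1, by simp [MarkedRoot]⟩
  | allR p ih => exact ⟨.allR fun t => (ih t (hU t) (hS t)).1, by simp [MarkedRoot]⟩
  | exR t p ih => exact ⟨.exR t (ih hU hS).1, by simp [MarkedRoot]⟩
  | bangR p ih => exact ⟨.bangR (ih hU hS).1, by simp [MarkedRoot]⟩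
  | oplusR₁ p ih => exact ⟨.oplusR₁ (ih hU hS).1, by simp [MarkedRoot]⟩
  | oplusR₂ p ih => exact ⟨.oplusR₂ (ih hU hS).1, by simp [MarkedRoot]⟩
  | tensorR p q ih₁ ih₂ =>
    exact ⟨.tensorR (ih₁ hU.1 hS.1).1 (ih₂ hU.2 hS.2).1, by simp [MarkedRoot]⟩

/-- The coincided proofs that a focused derivation denotes: `none` denotes any proof of the sequent,
`some F` a proof whose root decomposes the marked formula `F`. -/
def HasCoincidedProof {α T : Type} (Γ : Set (PF α T)) (Δ : Multiset (PF α T)) :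
    Option (PF α T) → GF α T → Prop
  | none, G => ∃ p : Proof Γ Δ G, Uniform p ∧ Simple p ∧ Coincided p
  | some F, G => ∃ p : Proof Γ (F ::ₘ Δ) G,
      (Uniform p ∧ Simple p ∧ Coincided p) ∧ MarkedRoot p F ∧ PrincipalRoot p F

theorem Focused.hasCoincidedProof {α T : Type} {Γ : Set (PF α T)} {Δ : Multiset (PF α T)}
    {o : Option (PF α T)} {G : GF α T} (h : Focused Γ Δ o G) : HasCoincidedProof Γ Δ o G := by
  induction h with
  | id Γ a => exact ⟨.id Γ a, by simp [Uniform, Simple, Coincided, MarkedRoot, PrincipalRoot]⟩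
  | conjL₁ B₁ B₂ _ ih =>
    obtain ⟨p, ⟨hU, hS, hC⟩, hM, -⟩ := ih
    exact ⟨.conjL₁ B₁ B₂ p, by
      simp_all [Uniform, Simple, Coincided, MarkedRoot, PrincipalRoot, AtomicGoal]⟩
  | conjL₂ B₁ B₂ _ ih =>
    obtain ⟨p, ⟨hU, hS, hC⟩, hM, -⟩ := ih
    exact ⟨.conjL₂ B₁ B₂ p, by
      simp_all [Uniform, Simple, Coincided, MarkedRoot, PrincipalRoot, AtomicGoal]⟩
  | limpL G F _ _ ih₁ ih₂ =>
    obtain ⟨p, hp⟩ := ih₁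
    obtain ⟨q, ⟨hU, hS, hC⟩, hM, -⟩ := ih₂
    exact ⟨.limpL G F p q, by
      simp_all [Uniform, Simple, Coincided, MarkedRoot, PrincipalRoot, AtomicGoal]⟩
  | impL G F _ _ ih₁ ih₂ =>
    obtain ⟨p, hp⟩ := ih₁
    obtain ⟨q, ⟨hU, hS, hC⟩, hM, -⟩ := ih₂
    exact ⟨.impL G F p q, by
      simp_all [Uniform, Simple, Coincided, MarkedRoot, PrincipalRoot, AtomicGoal]⟩
  | allL F t _ ih =>
    obtain ⟨p, ⟨hU, hS, hC⟩, hM, -⟩ := ih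
    exact ⟨.allL F t p, by
      simp_all [Uniform, Simple, Coincided, MarkedRoot, PrincipalRoot, AtomicGoal]⟩
  | focus F _ ih =>
    obtain ⟨p, hp, -⟩ := ih
    exact ⟨p, hp⟩
  | absorb F hF _ ih =>
    obtain ⟨p, ⟨hU, hS, hC⟩, -, hP⟩ := ih
    exact ⟨.absorb F hF p, ⟨trivial, hU⟩, hS, hP, hC⟩
  | topR Γ Δ => exact ⟨.topR Γ Δ, trivial, trivial, trivial⟩
  | conjR _ _ ih₁ ih₂ =>
    obtain ⟨p, hU, hS, hC⟩ := ih₁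
    obtain ⟨q, hU', hS', hC'⟩ := ih₂
    exact ⟨.conjR p q, ⟨hU, hU'⟩, ⟨hS, hS'⟩, hC, hC'⟩
  | limpR _ ih =>
    obtain ⟨p, hp⟩ := ih
    exact ⟨.limpR p, hp⟩
  | impR _ ih =>
    obtain ⟨p, hp⟩ := ih
    exact ⟨.impR p, hp⟩
  | allR _ ih =>
    choose p hU hS hC using ih
    exact ⟨.allR p, hU, hS, hC⟩
  | exR t _ ih =>
    obtain ⟨p, hp⟩ := ih
    exact ⟨.exR t p, hp⟩
  | bangR _ ih =>
    obtain ⟨p, hp⟩ := ih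
    exact ⟨.bangR p, hp⟩
  | oplusR₁ _ ih =>
    obtain ⟨p, hp⟩ := ih
    exact ⟨.oplusR₁ p, hp⟩
  | oplusR₂ _ ih =>
    obtain ⟨p, hp⟩ := ih
    exact ⟨.oplusR₂ p, hp⟩
  | tensorR _ _ ih₁ ih₂ =>
    obtain ⟨p, hU, hS, hC⟩ := ih₁
    obtain ⟨q, hU', hS', hC'⟩ := ih₂
    exact ⟨.tensorR p q, ⟨hU, hU'⟩, ⟨hS, hS'⟩, hC, hC'⟩

/-- **Lolli admits coincided provability**: a Lolli sequent `Γ ; Δ ⊢ G` has a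
simple proof (a uniform proof in which every left-introduction rule instance
acts on a marked principal formula) if and only if it has a coincided proof
(a simple proof in which every `absorb` instance is directly followed by a
left-introduction or `id` rule instance whose principal formula is the
absorbed copy). -/
theorem lolli_admits_coincided_provability {α T : Type}
    (Γ : Set (PF α T)) (Δ : Multiset (PF α T)) (G : GF α T) :
    (∃ p : Proof Γ Δ G, Uniform p ∧ Simple p) ↔
      ∃ p : Proof Γ Δ G, Uniform p ∧ Simple p ∧ Coincided p := by
  constructor
  · rintro ⟨p, hU, hS⟩
    exact (p.exists_focused hU hS).1.hasCoincidedProof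
  · rintro ⟨p, hU, hS, -⟩
    exact ⟨p, hU, hS⟩
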